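/- Let r^E be an anonymous recursive tournament rule with a matching elimination rule, let ε ∈ [0,1/2], let T be a weakly ε-bounded independent probabilistic tournament on n teams, let S = {u,v}, and let T' be any tournament S-adjacent to T. Then E_{M←E(n)}[(r^E_S(T'|_M) − r^E_S(T|_M)) · 1_{(u,v)∈M}] ≤ 2ε(1/2 + ε) · Pr_{M←E(n)}[(u,v) ∈ M]; that is, the expected manipulation gain conditioned on the bad terminal event (the (u,v) match being played in the first round) is at most 2ε(1/2 + ε). -/

import Mathlib

open scoped Classical
open Finset

/-! ## Basic tournament notions -/

/-- The set of potential matches among `n` teams: ordered pairs `(i, j)` with `i < j`. -/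
abbrev MatchPair (n : ℕ) := {q : Fin n × Fin n // q.1 < q.2}

/-- A deterministic (round robin) tournament on `n` teams: for each pair `i < j`,
`true` means that `i` beats `j`. -/
abbrev Outcome (n : ℕ) := MatchPair n → Bool

/-- `Outcome.beats o i j` holds when team `i` beats team `j` (it is `false` when `i = j`). -/
def Outcome.beats {n : ℕ} (o : Outcome n) (i j : Fin n) : Bool :=
  if h : i < j then o ⟨(i, j), h⟩
  else if h' : j < i then !o ⟨(j, i), h'⟩
  else false

/-- An independent probabilistic tournament on `n` teams: `p i j` is the probability
that `i` beats `j`, with `p i j + p j i = 1` for `i ≠ j`. -/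
structure ProbTournament (n : ℕ) where
  p : Fin n → Fin n → ℝ
  mem_Icc : ∀ i j : Fin n, p i j ∈ Set.Icc (0 : ℝ) 1
  compl : ∀ i j : Fin n, i ≠ j → p i j + p j i = 1

/-- The probability of the deterministic outcome `o` when all matches are independent
with probabilities given by `T`. -/
noncomputable def ProbTournament.prob {n : ℕ} (T : ProbTournament n) (o : Outcome n) : ℝ :=
  ∏ e : MatchPair n, (if o e then T.p e.val.1 e.val.2 else T.p e.val.2 e.val.1)

/-- `rP r T i`: the probability that team `i` wins when rule `r` is applied to the
independent probabilistic tournament `T`. -/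
noncomputable def rP (r : ∀ n : ℕ, Outcome n → Fin n → ℝ) {n : ℕ}
    (T : ProbTournament n) (i : Fin n) : ℝ :=
  ∑ o : Outcome n, T.prob o * r n o i

/-- `rPS r T S`: the probability that the winner lies in `S`. -/
noncomputable def rPS (r : ∀ n : ℕ, Outcome n → Fin n → ℝ) {n : ℕ}
    (T : ProbTournament n) (S : Finset (Fin n)) : ℝ :=
  ∑ i ∈ S, rP r T i

/-- A tournament rule assigns a probability distribution over the teams to every
deterministic tournament. -/
def IsTournamentRule (r : ∀ n : ℕ, Outcome n → Fin n → ℝ) : Prop :=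
  (∀ (n : ℕ) (o : Outcome n) (i : Fin n), 0 ≤ r n o i) ∧
  (∀ n : ℕ, 0 < n → ∀ o : Outcome n, ∑ i : Fin n, r n o i = 1)

/-- A rule is Condorcet-consistent if an undefeated team wins with probability 1. -/
def CondorcetConsistent (r : ∀ n : ℕ, Outcome n → Fin n → ℝ) : Prop :=
  ∀ (n : ℕ) (o : Outcome n) (i : Fin n),
    (∀ j : Fin n, j ≠ i → Outcome.beats o i j = true) → r n o i = 1

/-- Two independent probabilistic tournaments are `S`-adjacent if they agree on every
match that is not between two members of `S`. -/
def Adjacent {n : ℕ} (S : Finset (Fin n)) (T T' : ProbTournament n) : Prop :=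
  ∀ i j : Fin n, ¬(i ∈ S ∧ j ∈ S) → T.p i j = T'.p i j

/-- Weakly ε-bounded: all match probabilities lie in `[1/2 - ε, 1/2 + ε]`. -/
def WeaklyBounded (ε : ℝ) (n : ℕ) (T : ProbTournament n) : Prop :=
  ∀ i j : Fin n, i ≠ j → T.p i j ∈ Set.Icc (1/2 - ε) (1/2 + ε)

/-- Strictly ε-bounded: all match probabilities lie in `{1/2 - ε, 1/2 + ε}`. -/
def StrictlyBounded (ε : ℝ) (n : ℕ) (T : ProbTournament n) : Prop :=
  ∀ i j : Fin n, i ≠ j → T.p i j = 1/2 - ε ∨ T.p i j = 1/2 + ε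

/-- `alph r k C`: the manipulability `α_k^r(C)`, i.e. the supremum over tournaments in the
class `C` (on any number of teams), sets `S` of at most `k` teams, and `S`-adjacent
manipulations `T'`, of the gain `r_S(T') - r_S(T)`. -/
noncomputable def alph (r : ∀ n : ℕ, Outcome n → Fin n → ℝ) (k : ℕ)
    (C : ∀ n : ℕ, ProbTournament n → Prop) : ℝ :=
  sSup {x : ℝ | ∃ (n : ℕ) (T T' : ProbTournament n) (S : Finset (Fin n)),
    C n T ∧ S.card ≤ k ∧ Adjacent S T T' ∧ x = rPS r T' S - rPS r T S}

/-! ## Anonymity -/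

/-- The relabeling of an outcome by a permutation `σ`: in `permOutcome σ o`,
team `σ i` beats team `σ j` exactly when `i` beats `j` in `o`. -/
def permOutcome {n : ℕ} (σ : Equiv.Perm (Fin n)) (o : Outcome n) : Outcome n :=
  fun e => Outcome.beats o (σ.symm e.val.1) (σ.symm e.val.2)

/-- A tournament rule is anonymous if relabeling the teams relabels the winner
distribution accordingly. -/
def IsAnonymous (r : ∀ n : ℕ, Outcome n → Fin n → ℝ) : Prop :=
  ∀ (n : ℕ) (σ : Equiv.Perm (Fin n)) (o : Outcome n) (i : Fin n),
    r n (permOutcome σ o) (σ i) = r n o i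

/-! ## Elimination rules and recursive tournament rules -/

/-- An elimination rule: for every number `n > 1` of teams, a distribution `d n` over
sets `M` of matches to be played, with `1 ≤ |M| ≤ n - 1` on the support. -/
structure ElimRule where
  d : ∀ n : ℕ, Finset (MatchPair n) → ℝ
  nonneg : ∀ (n : ℕ) (M : Finset (MatchPair n)), 0 ≤ d n M
  sum_one : ∀ n : ℕ, 1 < n → ∑ M : Finset (MatchPair n), d n M = 1
  supp : ∀ (n : ℕ) (M : Finset (MatchPair n)), 1 < n → d n M ≠ 0 →
    1 ≤ M.card ∧ M.card ≤ n - 1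

/-- A set of matches is a matching when no team appears in two distinct matches. -/
def IsMatchingSet {n : ℕ} (M : Finset (MatchPair n)) : Prop :=
  ∀ e ∈ M, ∀ e' ∈ M, e ≠ e' →
    e.val.1 ≠ e'.val.1 ∧ e.val.1 ≠ e'.val.2 ∧ e.val.2 ≠ e'.val.1 ∧ e.val.2 ≠ e'.val.2

/-- A matching elimination rule only ever selects matchings. -/
def ElimRule.IsMatchingRule (E : ElimRule) : Prop :=
  ∀ (n : ℕ) (M : Finset (MatchPair n)), E.d n M ≠ 0 → IsMatchingSet M

/-- Team `i` loses one of the matches in `M` under the outcome `o`. -/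
def losesIn {n : ℕ} (o : Outcome n) (M : Finset (MatchPair n)) (i : Fin n) : Prop :=
  ∃ e ∈ M, (e.val.1 = i ∧ Outcome.beats o e.val.2 i = true) ∨
           (e.val.2 = i ∧ Outcome.beats o e.val.1 i = true)

/-- The teams surviving the matches `M` (i.e. not losing any match of `M`). -/
noncomputable def survivors {n : ℕ} (o : Outcome n) (M : Finset (MatchPair n)) :
    Finset (Fin n) :=
  Finset.univ.filter (fun i => ¬ losesIn o M i)

/-- The induced sub-outcome on the teams of `s`, reindexed by `Fin s.card` in
increasing order. -/
noncomputable def restrictOutcome {n : ℕ} (o : Outcome n) (s : Finset (Fin n)) :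
    Outcome s.card :=
  fun e => Outcome.beats o (↑(s.orderIsoOfFin rfl e.val.1)) (↑(s.orderIsoOfFin rfl e.val.2))

/-- The induced probabilistic subtournament on the teams of `s` (same match
probabilities), reindexed by `Fin s.card` in increasing order. -/
noncomputable def restrictProb {n : ℕ} (T : ProbTournament n) (s : Finset (Fin n)) :
    ProbTournament s.card where
  p a b := T.p ↑(s.orderIsoOfFin rfl a) ↑(s.orderIsoOfFin rfl b)
  mem_Icc _ _ := T.mem_Icc _ _
  compl a b hab := T.compl _ _
    (fun h => hab ((s.orderIsoOfFin rfl).injective (Subtype.coe_injective h)))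

/-- The subset of `Fin s.card` corresponding to the members of `S` that lie in `s`. -/
noncomputable def mapTeams {n : ℕ} (s : Finset (Fin n)) (S : Finset (Fin n)) :
    Finset (Fin s.card) :=
  Finset.univ.filter (fun a => (↑(s.orderIsoOfFin rfl a) : Fin n) ∈ S)

/-- Fueled recursion computing the winner distribution of the recursive tournament rule
`r^E`: sample `M ← E(n)`, eliminate all losers of matches in `M`, recurse on survivors. -/
noncomputable def recWinAux (E : ElimRule) : ℕ → ∀ n : ℕ, Outcome n → Fin n → ℝ
  | 0, n, _, _ => if n = 1 then 1 else 0
  | fuel + 1, n, o, i =>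
    if n ≤ 1 then (if n = 1 then 1 else 0)
    else ∑ M : Finset (MatchPair n), E.d n M *
      (if h : i ∈ survivors o M then
        recWinAux E fuel (survivors o M).card (restrictOutcome o (survivors o M))
          (((survivors o M).orderIsoOfFin rfl).symm ⟨i, h⟩)
      else 0)

/-- The recursive tournament rule `r^E` determined by the elimination rule `E`. -/
noncomputable def recWin (E : ElimRule) : ∀ n : ℕ, Outcome n → Fin n → ℝ :=
  fun n => recWinAux E n n

/-- `matchMem M u v`: the match between `u` and `v` belongs to `M`. -/
def matchMem {n : ℕ} (M : Finset (MatchPair n)) (u v : Fin n) : Prop :=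
  ∃ e ∈ M, e.val = (u, v) ∨ e.val = (v, u)

/-- `valAfter r T M S`: the expected probability that the winner lies in `S` when the
matches in `M` are played with outcomes drawn from `T`, the losers are eliminated, and
`r` is then run on the induced probabilistic subtournament `T|_M` of the survivors
(with the convention that eliminated teams win with probability `0`). -/
noncomputable def valAfter (r : ∀ n : ℕ, Outcome n → Fin n → ℝ) {n : ℕ}
    (T : ProbTournament n) (M : Finset (MatchPair n)) (S : Finset (Fin n)) : ℝ :=
  ∑ o : Outcome n, T.prob o *
    rPS r (restrictProb T (survivors o M)) (mapTeams (survivors o M) S)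

/-- `U` is a base case for the manipulating coalition `S` under rule `r`:
no `S`-adjacent manipulation gains anything, i.e. `α_S^r(U) = 0`. -/
def IsBaseCase (r : ∀ n : ℕ, Outcome n → Fin n → ℝ) {m : ℕ}
    (U : ProbTournament m) (S : Finset (Fin m)) : Prop :=
  ∀ U' : ProbTournament m, Adjacent S U U' → rPS r U' S - rPS r U S ≤ 0

/-! ## Gauntlets -/

/-- The tournament obtained from `o` by letting `u` beat every other team, keeping all
other matches intact. -/
def condorcetify {n : ℕ} (o : Outcome n) (u : Fin n) : Outcome n :=
  fun e => if e.val.1 = u then true else if e.val.2 = u then false else o e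

/-- The opponents of `u` among the matches in `M`. -/
noncomputable def opponents {n : ℕ} (M : Finset (MatchPair n)) (u : Fin n) :
    Finset (Fin n) :=
  (M.filter (fun e => e.val.1 = u)).image (fun e => e.val.2) ∪
  (M.filter (fun e => e.val.2 = u)).image (fun e => e.val.1)

/-- Fueled recursion for the distribution of the gauntlet of `u`: the set of opponents
that `u` plays in elimination matches when `r^E` is executed on a tournament in which
`u` beats everybody (the input `o` is assumed already so modified).  The value is the
probability, over the internal randomness of `E`, that the gauntlet equals `g`
(recorded as a set of teams of the outermost tournament). -/
noncomputable def gauntletDistAux (E : ElimRule) :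
    ℕ → ∀ n : ℕ, Outcome n → Fin n → Finset (Fin n) → ℝ
  | 0, _, _, _, g => if g = ∅ then 1 else 0
  | fuel + 1, n, o, u, g =>
    if n ≤ 1 then (if g = ∅ then 1 else 0)
    else ∑ M : Finset (MatchPair n), E.d n M *
      (if h : u ∈ survivors o M ∧ opponents M u ⊆ g ∧ g \ opponents M u ⊆ survivors o M then
        gauntletDistAux E fuel (survivors o M).card (restrictOutcome o (survivors o M))
          (((survivors o M).orderIsoOfFin rfl).symm ⟨u, h.1⟩)
          (Finset.univ.filter (fun a =>
            (↑((survivors o M).orderIsoOfFin rfl a) : Fin n) ∈ g \ opponents M u))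
      else 0)

/-- `gauntletDist E n o u g`: the probability that the gauntlet `G^{r^E}_u(o)` of team
`u` in the deterministic tournament `o` equals the set `g`. -/
noncomputable def gauntletDist (E : ElimRule) (n : ℕ) (o : Outcome n) (u : Fin n)
    (g : Finset (Fin n)) : ℝ :=
  gauntletDistAux E n n (condorcetify o u) u g

/-- `gauntletProbP E T u g`: the probability that the gauntlet `G^{r^E}_u(T)` of team `u`
in the independent probabilistic tournament `T` equals the set `g` (first sampling a
deterministic tournament from `T`, then the gauntlet). -/
noncomputable def gauntletProbP (E : ElimRule) {n : ℕ} (T : ProbTournament n)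
    (u : Fin n) (g : Finset (Fin n)) : ℝ :=
  ∑ o : Outcome n, T.prob o * gauntletDist E n o u g

/-- Given the first-round outcome `o` and matches `M`, the probability that the gauntlet
of team `x` in the surviving probabilistic subtournament `T|_M` equals the set `g`
(where `g` is recorded with the original team labels). -/
noncomputable def gauntletEventProb (E : ElimRule) {n : ℕ} (T : ProbTournament n)
    (M : Finset (MatchPair n)) (x : Fin n) (g : Finset (Fin n)) (o : Outcome n) : ℝ :=
  if h : x ∈ survivors o M ∧ g ⊆ survivors o M then
    gauntletProbP E (restrictProb T (survivors o M))
      (((survivors o M).orderIsoOfFin rfl).symm ⟨x, h.1⟩)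
      (Finset.univ.filter (fun a =>
        (↑((survivors o M).orderIsoOfFin rfl a) : Fin n) ∈ g))
  else 0

/-! ## Randomized Death Match -/

/-- Fueled recursion for Randomized Death Match: pick one of the `n.choose 2` matches
uniformly at random, eliminate the loser, recurse. -/
noncomputable def RDMAux : ℕ → ∀ n : ℕ, Outcome n → Fin n → ℝ
  | 0, n, _, _ => if n = 1 then 1 else 0
  | fuel + 1, n, o, i =>
    if n ≤ 1 then (if n = 1 then 1 else 0)
    else ((n.choose 2 : ℝ))⁻¹ * ∑ e : MatchPair n,
      (if h : i ∈ survivors o {e} then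
        RDMAux fuel (survivors o {e}).card (restrictOutcome o (survivors o {e}))
          (((survivors o {e}).orderIsoOfFin rfl).symm ⟨i, h⟩)
      else 0)

/-- Randomized Death Match. -/
noncomputable def RDM : ∀ n : ℕ, Outcome n → Fin n → ℝ :=
  fun n => RDMAux n n

/-! ## Randomized Single Elimination Bracket -/

/-- `nextPow2 n = 2 ^ ⌈log₂ n⌉`. -/
def nextPow2 (n : ℕ) : ℕ := 2 ^ Nat.clog 2 n

/-- Extend a tournament on `n` teams to `nextPow2 n` teams by adding dummy teams that
lose to all original teams (among themselves, the dummy with lower index wins). -/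
def extendOutcome {n : ℕ} (o : Outcome n) : Outcome (nextPow2 n) :=
  fun e =>
    if h : (e.val.2 : ℕ) < n then
      Outcome.beats o ⟨(e.val.1 : ℕ), lt_trans (Fin.lt_def.mp e.2) h⟩ ⟨(e.val.2 : ℕ), h⟩
    else true

/-- Fueled recursion for Randomized Single Elimination Bracket (after dummies have been
added): pick a uniformly random maximum matching on the remaining teams, play those
matches, eliminate all losers, recurse. -/
noncomputable def RSEBAux : ℕ → ∀ n : ℕ, Outcome n → Fin n → ℝ
  | 0, n, _, _ => if n = 1 then 1 else 0
  | fuel + 1, n, o, i =>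
    if n ≤ 1 then (if n = 1 then 1 else 0)
    else
      ((Finset.univ.filter
          (fun M : Finset (MatchPair n) => IsMatchingSet M ∧ M.card = n / 2)).card : ℝ)⁻¹ *
        ∑ M ∈ Finset.univ.filter
            (fun M : Finset (MatchPair n) => IsMatchingSet M ∧ M.card = n / 2),
          (if h : i ∈ survivors o M then
            RSEBAux fuel (survivors o M).card (restrictOutcome o (survivors o M))
              (((survivors o M).orderIsoOfFin rfl).symm ⟨i, h⟩)
          else 0)

/-- Randomized Single Elimination Bracket. -/
noncomputable def RSEB : ∀ n : ℕ, Outcome n → Fin n → ℝ :=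
  fun n o i =>
    RSEBAux (nextPow2 n) (nextPow2 n) (extendOutcome o)
      (Fin.castLE (Nat.le_pow_clog one_lt_two n) i)

/-! ## Statement -/

/-! ## Proof -/

theorem beats_self {n : ℕ} (o : Outcome n) (i : Fin n) : Outcome.beats o i i = false := by
  simp [Outcome.beats]

theorem beats_swap {n : ℕ} (o : Outcome n) {i j : Fin n} (h : i ≠ j) :
    Outcome.beats o j i = !Outcome.beats o i j := by
  unfold Outcome.beats
  rcases lt_or_gt_of_ne h with h | h
  · simp [h, h.le, not_lt.mpr h.le]
  · simp [h, h.le, not_lt.mpr h.le]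

theorem beats_condorcetify {n : ℕ} (o : Outcome n) (a i j : Fin n) :
    Outcome.beats (condorcetify o a) i j =
      if i = a then decide (j ≠ a) else if j = a then false else Outcome.beats o i j := by
  unfold Outcome.beats condorcetify
  rcases lt_trichotomy i j with h | h | h
  · by_cases h1 : i = a <;> by_cases h2 : j = a <;> simp_all
  · subst h; by_cases h1 : i = a <;> simp_all
  · have h3 := not_lt.mpr h.le
    by_cases h1 : i = a <;> by_cases h2 : j = a <;> simp_all

theorem beats_restrict {n : ℕ} (o : Outcome n) (s : Finset (Fin n)) (i j : Fin s.card) :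
    Outcome.beats (restrictOutcome o s) i j =
      Outcome.beats o (s.orderIsoOfFin rfl i) (s.orderIsoOfFin rfl j) := by
  rcases lt_trichotomy i j with h | h | h
  · simp [Outcome.beats, restrictOutcome, h]
  · subst h; simp [beats_self]
  · rw [beats_swap _ h.ne, beats_swap (o := o) (i := s.orderIsoOfFin rfl j)]
    · congr 1
      simp [Outcome.beats, restrictOutcome, h]
    · intro h'
      exact h.ne ((s.orderIsoOfFin rfl).injective (Subtype.coe_injective h'))

theorem beats_perm {n : ℕ} (σ : Equiv.Perm (Fin n)) (o : Outcome n) (i j : Fin n) :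
    Outcome.beats (permOutcome σ o) i j = Outcome.beats o (σ.symm i) (σ.symm j) := by
  rcases lt_trichotomy i j with h | h | h
  · simp [Outcome.beats, permOutcome, h]
  · subst h; simp [beats_self]
  · rw [beats_swap _ h.ne, beats_swap (o := o) (i := σ.symm j)]
    · congr 1
      simp [Outcome.beats, permOutcome, h]
    · intro h'
      exact h.ne (σ.symm.injective h')

theorem outcome_ext {n : ℕ} {o o' : Outcome n}
    (h : ∀ i j, Outcome.beats o i j = Outcome.beats o' i j) : o = o' := by
  funext e
  have := h e.1.1 e.1.2
  simpa [Outcome.beats, e.2] using this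

/-! ### Powers and products -/

theorem pow_diff_le {ε : ℝ} (hε : ε ∈ Set.Icc (0 : ℝ) (1/2)) (k : ℕ) :
    (1/2 + ε)^k - (1/2 - ε)^k ≤ 2*ε := by
  obtain ⟨h0, h1⟩ := hε
  induction k with
  | zero => simp; exact h0
  | succ k ih =>
    rcases Nat.eq_zero_or_pos k with rfl | hk
    · simp; linarith
    · have hlo : (1/2 - ε)^k ≤ 1/2 - ε := by
        apply pow_le_of_le_one <;> first | linarith | omega
      have e1 : (1/2 + ε)^(k+1) - (1/2 - ε)^(k+1)
        = (1/2+ε) * ((1/2 + ε)^k - (1/2 - ε)^k) + 2*ε*(1/2-ε)^k := by ring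
      rw [e1]
      nlinarith

theorem prod_diff_le {ι : Type*} {ε : ℝ} (hε : ε ∈ Set.Icc (0 : ℝ) (1/2)) (s : Finset ι)
    (x y : ι → ℝ) (hx : ∀ i ∈ s, x i ∈ Set.Icc (1/2 - ε) (1/2 + ε))
    (hy : ∀ i ∈ s, y i ∈ Set.Icc (1/2 - ε) (1/2 + ε)) :
    |∏ i ∈ s, x i - ∏ i ∈ s, y i| ≤ 2*ε := by
  have hlo : (0:ℝ) ≤ 1/2 - ε := by linarith [hε.2]
  have key : ∀ z : ι → ℝ, (∀ i ∈ s, z i ∈ Set.Icc (1/2 - ε) (1/2 + ε)) →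
      (1/2-ε)^s.card ≤ ∏ i ∈ s, z i ∧ ∏ i ∈ s, z i ≤ (1/2+ε)^s.card := by
    intro z hz
    constructor
    · rw [← Finset.prod_const]
      exact Finset.prod_le_prod (fun _ _ => hlo) (fun i hi => (hz i hi).1)
    · rw [← Finset.prod_const]
      exact Finset.prod_le_prod (fun i hi => hlo.trans (hz i hi).1) (fun i hi => (hz i hi).2)
  have := pow_diff_le hε s.card
  have h1 := key x hx
  have h2 := key y hy
  rw [abs_le]; constructor <;> linarith

/-! ### Gauntlet representation -/

/-- Indicator that all bits in `g` are set. -/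
noncomputable def gInd {n : ℕ} (g : Finset (Fin n)) (b : Fin n → Bool) : ℝ :=
  ∏ w ∈ g, (if b w then 1 else 0)

/-- Generators. -/
def gGen (n : ℕ) (a : Fin n) : Set ((Fin n → Bool) → ℝ) :=
  {f | f = 0 ∨ ∃ g : Finset (Fin n), a ∉ g ∧ f = gInd g}

/-- Their convex hull. -/
def gHull (n : ℕ) (a : Fin n) : Set ((Fin n → Bool) → ℝ) := convexHull ℝ (gGen n a)

theorem zero_mem_gHull {n : ℕ} (a : Fin n) : (0 : (Fin n → Bool) → ℝ) ∈ gHull n a :=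
  subset_convexHull _ _ (Or.inl rfl)

theorem one_mem_gHull {n : ℕ} (a : Fin n) : (fun _ => 1 : (Fin n → Bool) → ℝ) ∈ gHull n a :=
  subset_convexHull _ _ (Or.inr ⟨∅, by simp, by funext b; simp [gInd]⟩)

theorem step_mem_gHull {n m : ℕ} (a : Fin n) (a' : Fin m) (ι : Fin m → Fin n)
    (hι : Function.Injective ι) (ha : ι a' = a) (g : Finset (Fin n)) (hg : a ∉ g)
    (f : (Fin m → Bool) → ℝ) (hf : f ∈ gHull m a') :
    (fun b => gInd g b * f (b ∘ ι)) ∈ gHull n a := by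
  let φ : ((Fin m → Bool) → ℝ) →ₗ[ℝ] ((Fin n → Bool) → ℝ) :=
    { toFun := fun f b => gInd g b * f (b ∘ ι)
      map_add' := by intro f f'; funext b; simp [mul_add]
      map_smul' := by intro c f; funext b; simp [mul_left_comm] }
  have h1 : φ f ∈ φ '' (gHull m a') := ⟨f, hf, rfl⟩
  unfold gHull at h1
  rw [LinearMap.image_convexHull] at h1
  refine convexHull_mono ?_ h1
  rintro _ ⟨f, hf, rfl⟩
  rcases hf with rfl | ⟨g', hg', rfl⟩
  · left; simp
  · right
    refine ⟨g ∪ g'.image ι, ?_, ?_⟩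
    · simp only [Finset.mem_union, Finset.mem_image, not_or, not_exists, not_and]
      refine ⟨hg, fun x hx h => hg' ?_⟩
      rw [← ha] at h
      rwa [← hι h]
    · funext b
      simp only [φ, LinearMap.coe_mk, AddHom.coe_mk, gInd, Finset.prod_boole]
      by_cases h1 : ∀ i ∈ g, b i = true
      · by_cases h2 : ∀ i ∈ g', b (ι i) = true
        · have : ∀ i ∈ g ∪ g'.image ι, b i = true := by
            intro i hi
            simp only [Finset.mem_union, Finset.mem_image] at hi
            rcases hi with hi | ⟨j, hj, rfl⟩
            · exact h1 i hi
            · exact h2 j hj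
          rw [if_pos h1, if_pos this, if_pos (by simpa using h2)]; simp
        · have : ¬ ∀ i ∈ g ∪ g'.image ι, b i = true := by
            intro h; apply h2; intro i hi
            exact h _ (Finset.mem_union_right _ (Finset.mem_image_of_mem _ hi))
          rw [if_neg this, if_neg (c := ∀ i ∈ g', (b ∘ ι) i = true) (by simpa using h2)]; simp
      · have : ¬ ∀ i ∈ g ∪ g'.image ι, b i = true := by
          intro h; apply h1; intro i hi
          exact h _ (Finset.mem_union_left _ hi)
        rw [if_neg this, if_neg h1]; simp

theorem mem_opponents {n : ℕ} (M : Finset (MatchPair n)) (u w : Fin n) :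
    w ∈ opponents M u ↔ ∃ e ∈ M, e.val = (u, w) ∨ e.val = (w, u) := by
  unfold opponents
  simp only [Finset.mem_union, Finset.mem_image, Finset.mem_filter]
  constructor
  · rintro (⟨e, ⟨h1, h2⟩, h3⟩ | ⟨e, ⟨h1, h2⟩, h3⟩)
    · exact ⟨e, h1, Or.inl (Prod.ext h2 h3)⟩
    · exact ⟨e, h1, Or.inr (Prod.ext h3 h2)⟩
  · rintro ⟨e, h1, h | h⟩
    · exact Or.inl ⟨e, ⟨h1, by rw [h]⟩, by rw [h]⟩
    · exact Or.inr ⟨e, ⟨h1, by rw [h]⟩, by rw [h]⟩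

theorem self_not_mem_opponents {n : ℕ} (M : Finset (MatchPair n)) (u : Fin n) :
    u ∉ opponents M u := by
  rw [mem_opponents]
  rintro ⟨e, -, h | h⟩ <;> · have := e.2; rw [h] at this; exact lt_irrefl _ this

theorem losesIn_iff {n : ℕ} (o : Outcome n) (M : Finset (MatchPair n)) (i : Fin n) :
    losesIn o M i ↔ ∃ j ∈ opponents M i, Outcome.beats o j i = true := by
  unfold losesIn
  constructor
  · rintro ⟨e, he, ⟨h1, h2⟩ | ⟨h1, h2⟩⟩
    · exact ⟨_, (mem_opponents _ _ _).2 ⟨e, he, Or.inl (Prod.ext h1 rfl)⟩, h2⟩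
    · exact ⟨_, (mem_opponents _ _ _).2 ⟨e, he, Or.inr (Prod.ext rfl h1)⟩, h2⟩
  · rintro ⟨j, hj, hb⟩
    obtain ⟨e, he, h | h⟩ := (mem_opponents _ _ _).1 hj
    · exact ⟨e, he, Or.inl ⟨by rw [h], by rw [h]; exact hb⟩⟩
    · exact ⟨e, he, Or.inr ⟨by rw [h], by rw [h]; exact hb⟩⟩

theorem opponents_symm {n : ℕ} {M : Finset (MatchPair n)} {u w : Fin n}
    (h : w ∈ opponents M u) : u ∈ opponents M w := by
  rw [mem_opponents] at *
  obtain ⟨e, he, h | h⟩ := h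
  · exact ⟨e, he, Or.inr h⟩
  · exact ⟨e, he, Or.inl h⟩

theorem mem_survivors_iff {n : ℕ} (o : Outcome n) (M : Finset (MatchPair n)) (i : Fin n) :
    i ∈ survivors o M ↔ ∀ j ∈ opponents M i, Outcome.beats o i j = true := by
  unfold survivors
  simp only [Finset.mem_filter, Finset.mem_univ, true_and, losesIn_iff, not_exists, not_and]
  refine forall₂_congr fun j hj => ?_
  have : i ≠ j := by rintro rfl; exact self_not_mem_opponents _ _ hj
  rw [beats_swap o this]; simp

theorem survivors_condorcetify {n : ℕ} (o o' : Outcome n) (M : Finset (MatchPair n)) (a : Fin n)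
    (hag : ∀ i j, i ≠ a → j ≠ a → Outcome.beats o' i j = Outcome.beats o i j)
    (hw : ∀ w ∈ opponents M a, Outcome.beats o' a w = true) :
    survivors o' M = survivors (condorcetify o a) M := by
  ext i
  rw [mem_survivors_iff, mem_survivors_iff]
  refine forall₂_congr fun j hj => ?_
  rw [beats_condorcetify]
  have hij : i ≠ j := by rintro rfl; exact self_not_mem_opponents _ _ hj
  by_cases hi : i = a
  · subst hi; simp [hw j hj, hij.symm]
  · by_cases hja : j = a
    · subst hja
      rw [beats_swap _ hij.symm, hw i (opponents_symm hj)]; simp [hi]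
    · simp [hi, hja, hag]

theorem gauntlet_rep (E : ElimRule) (fuel : ℕ) : ∀ (n : ℕ) (o : Outcome n) (a : Fin n),
    ∃ f ∈ gHull n a, ∀ o' : Outcome n,
      (∀ i j, i ≠ a → j ≠ a → Outcome.beats o' i j = Outcome.beats o i j) →
      recWinAux E fuel n o' a = f (fun w => Outcome.beats o' a w) := by
  have triv : ∀ (n : ℕ) (a : Fin n), ∃ f ∈ gHull n a, ∀ b, (if n = 1 then (1:ℝ) else 0) = f b := by
    intro n a
    by_cases h : n = 1
    · exact ⟨_, one_mem_gHull a, by simp [h]⟩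
    · exact ⟨_, zero_mem_gHull a, by simp [h]⟩
  induction fuel with
  | zero =>
    intro n o a
    obtain ⟨f, hf, h⟩ := triv n a
    exact ⟨f, hf, fun o' _ => by rw [recWinAux]; exact h _⟩
  | succ fuel ih =>
    intro n o a
    by_cases hn : n ≤ 1
    · obtain ⟨f, hf, h⟩ := triv n a
      exact ⟨f, hf, fun o' _ => by rw [recWinAux, if_pos hn]; exact h _⟩
    have hmem : ∀ M, a ∈ survivors (condorcetify o a) M := by
      intro M
      rw [mem_survivors_iff]
      intro j hj
      have : j ≠ a := by rintro rfl; exact self_not_mem_opponents _ _ hj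
      simp [beats_condorcetify, this]
    have hM : ∀ M : Finset (MatchPair n), ∃ f ∈ gHull n a, ∀ o' : Outcome n,
        (∀ i j, i ≠ a → j ≠ a → Outcome.beats o' i j = Outcome.beats o i j) →
        (if h : a ∈ survivors o' M then
        recWinAux E fuel (survivors o' M).card (restrictOutcome o' (survivors o' M))
          (((survivors o' M).orderIsoOfFin rfl).symm ⟨a, h⟩)
        else 0) = f (fun w => Outcome.beats o' a w) := by
      intro M
      have hs := hmem M
      have hsv := fun o' => survivors_condorcetify o o' M a
      generalize survivors (condorcetify o a) M = s at hs hsv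
      obtain ⟨f, hf, hfo⟩ := ih s.card (restrictOutcome o s) ((s.orderIsoOfFin rfl).symm ⟨a, hs⟩)
      refine ⟨_, step_mem_gHull a _ (fun i => (s.orderIsoOfFin rfl i : Fin n))
        (fun i j h => (s.orderIsoOfFin rfl).injective (Subtype.coe_injective h)) (by simp)
        (opponents M a) (self_not_mem_opponents M a) f hf, ?_⟩
      intro o' ho'
      by_cases hw : ∀ w ∈ opponents M a, Outcome.beats o' a w = true
      · have := hsv o' ho' hw
        have h2 := hfo (restrictOutcome o' s) (by
          intro i j hi hj
          rw [beats_restrict, beats_restrict]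
          apply ho'
          · rintro h; apply hi; rw [OrderIso.eq_symm_apply]; exact Subtype.ext h
          · rintro h; apply hj; rw [OrderIso.eq_symm_apply]; exact Subtype.ext h)
        subst this
        rw [dif_pos hs, h2]
        rw [gInd, Finset.prod_boole, if_pos hw]
        simp only [beats_restrict, OrderIso.apply_symm_apply]
        simp [Function.comp_def]
      · rw [gInd, Finset.prod_boole, if_neg hw, dif_neg]
        · simp
        · rwa [mem_survivors_iff]
    choose f hf hfo using hM
    refine ⟨∑ M, E.d n M • f M, ?_, ?_⟩
    · exact (convex_convexHull ℝ _).sum_mem (fun M _ => E.nonneg n M) (E.sum_one n (by omega))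
        (fun M _ => hf M)
    · intro o' ho'
      rw [recWinAux, if_neg hn]
      simp only [Finset.sum_apply, Pi.smul_apply, smul_eq_mul]
      exact Finset.sum_congr rfl fun M _ => by rw [hfo M o' ho']

/-! ### Averaging -/

/-- Probability of the result `b` of the match `e`. -/
noncomputable def mfac {n : ℕ} (T : ProbTournament n) (e : MatchPair n) (b : Bool) : ℝ :=
  if b then T.p e.val.1 e.val.2 else T.p e.val.2 e.val.1

theorem mfac_nonneg {n : ℕ} (T : ProbTournament n) (e : MatchPair n) (b : Bool) :
    0 ≤ mfac T e b := by
  unfold mfac; split_ifs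
  · exact (T.mem_Icc _ _).1
  · exact (T.mem_Icc _ _).1

theorem mfac_sum {n : ℕ} (T : ProbTournament n) (e : MatchPair n) :
    ∑ b : Bool, mfac T e b = 1 := by
  simp [mfac, T.compl _ _ e.2.ne]

theorem prob_eq {n : ℕ} (T : ProbTournament n) (o : Outcome n) :
    T.prob o = ∏ e, mfac T e (o e) := rfl

theorem sum_pi_prod {ι : Type*} [Fintype ι] [DecidableEq ι] (c : ι → Bool → ℝ) :
    ∑ o : ι → Bool, ∏ e, c e (o e) = ∏ e, ∑ b, c e b := by
  rw [Finset.prod_univ_sum, Fintype.piFinset_univ]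

theorem prob_sum {n : ℕ} (T : ProbTournament n) : ∑ o, T.prob o = 1 := by
  simp only [prob_eq]
  rw [sum_pi_prod]
  simp only [mfac_sum, Finset.prod_const_one]

/-- The match `e` involves team `a`. -/
def inv {n : ℕ} (a : Fin n) (e : MatchPair n) : Prop := e.val.1 = a ∨ e.val.2 = a

/-- The opponent of `a` in the match `e`. -/
noncomputable def oth {n : ℕ} (a : Fin n) (e : MatchPair n) : Fin n :=
  if e.val.1 = a then e.val.2 else e.val.1

theorem oth_ne {n : ℕ} (a : Fin n) (e : MatchPair n) : oth a e ≠ a := by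
  unfold oth; split_ifs with h
  · rw [← h]; exact e.2.ne'
  · exact h

theorem exists_oth {n : ℕ} {a w : Fin n} (h : w ≠ a) : ∃ e, inv a e ∧ oth a e = w := by
  rcases lt_or_gt_of_ne h with h | h
  · exact ⟨⟨(w, a), h⟩, Or.inr rfl, by simp [oth, h.ne]⟩
  · exact ⟨⟨(a, w), h⟩, Or.inl rfl, by simp [oth]⟩

theorem beats_oth {n : ℕ} (o : Outcome n) (a : Fin n) (e : MatchPair n) (h : inv a e) :
    Outcome.beats o a (oth a e) = true ↔ o e = decide (e.val.1 = a) := by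
  obtain ⟨⟨i, j⟩, hij⟩ := e
  simp only [inv, oth] at *
  rcases h with h | h
  · subst h; simp [Outcome.beats, hij]
  · subst h
    have h' := not_lt.mpr hij.le
    simp [Outcome.beats, hij, hij.ne, h']

theorem mfac_win {n : ℕ} (T : ProbTournament n) (a : Fin n) (e : MatchPair n) (h : inv a e) :
    mfac T e (decide (e.val.1 = a)) = T.p a (oth a e) := by
  obtain ⟨⟨i, j⟩, hij⟩ := e
  simp only [inv, oth, mfac] at *
  rcases h with h | h
  · subst h; simp
  · subst h
    have h2 := hij.ne
    simp [h2]

/-- Gluing the results of matches involving `a` with the others. -/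
noncomputable def glue {n : ℕ} (a : Fin n) (o1 : {e : MatchPair n // inv a e} → Bool)
    (o2 : {e : MatchPair n // ¬ inv a e} → Bool) : Outcome n :=
  (Equiv.piEquivPiSubtypeProd (inv a) (fun _ => Bool)).symm (o1, o2)

theorem glue_inv {n : ℕ} (a : Fin n) (o1 : {e : MatchPair n // inv a e} → Bool)
    (o2 : {e : MatchPair n // ¬ inv a e} → Bool) (e : MatchPair n) (h : inv a e) :
    glue a o1 o2 e = o1 ⟨e, h⟩ := by
  simp [glue, Equiv.piEquivPiSubtypeProd, h]

theorem glue_not_inv {n : ℕ} (a : Fin n) (o1 : {e : MatchPair n // inv a e} → Bool)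
    (o2 : {e : MatchPair n // ¬ inv a e} → Bool) (e : MatchPair n) (h : ¬ inv a e) :
    glue a o1 o2 e = o2 ⟨e, h⟩ := by
  simp [glue, Equiv.piEquivPiSubtypeProd, h]

theorem expect_split {n : ℕ} (T : ProbTournament n) (a : Fin n) (F : Outcome n → ℝ) :
    ∑ o, T.prob o * F o = ∑ o2 : {e : MatchPair n // ¬ inv a e} → Bool,
      (∏ e, mfac T e.1 (o2 e)) * ∑ o1 : {e : MatchPair n // inv a e} → Bool,
        (∏ e, mfac T e.1 (o1 e)) * F (glue a o1 o2) := by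
  rw [← Equiv.sum_comp (Equiv.piEquivPiSubtypeProd (inv a) (fun _ => Bool)).symm,
    Fintype.sum_prod_type_right]
  refine Finset.sum_congr rfl fun o2 _ => ?_
  rw [Finset.mul_sum]
  refine Finset.sum_congr rfl fun o1 _ => ?_
  change T.prob (glue a o1 o2) * F (glue a o1 o2) = _
  rw [← mul_assoc]
  congr 1
  rw [prob_eq, ← Fintype.prod_subtype_mul_prod_subtype (inv a), mul_comm]
  congr 1
  · exact Finset.prod_congr rfl fun e _ => by rw [glue_not_inv _ _ _ _ e.2]
  · exact Finset.prod_congr rfl fun e _ => by rw [glue_inv _ _ _ _ e.2]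

theorem gInd_bits {n : ℕ} (a : Fin n) (g : Finset (Fin n)) (hg : a ∉ g) (o : Outcome n) :
    gInd g (fun w => Outcome.beats o a w) = ∏ e : {e : MatchPair n // inv a e},
      (if oth a e.1 ∈ g → o e.1 = decide (e.1.val.1 = a) then (1 : ℝ) else 0) := by
  rw [gInd, Finset.prod_boole, Finset.prod_boole]
  congr 1
  apply propext
  constructor
  · intro h e _ he
    exact (beats_oth o a e.1 e.2).1 (h _ he)
  · intro h w hw
    obtain ⟨e, he, rfl⟩ := exists_oth (a := a) (w := w) (by rintro rfl; exact hg hw)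
    exact (beats_oth o a e he).2 (h ⟨e, he⟩ (Finset.mem_univ _) hw)

theorem gen_expect {n : ℕ} (T : ProbTournament n) (a : Fin n) (g : Finset (Fin n)) (hg : a ∉ g)
    (o2 : {e : MatchPair n // ¬ inv a e} → Bool) :
    ∑ o1 : {e : MatchPair n // inv a e} → Bool,
        (∏ e, mfac T e.1 (o1 e)) * gInd g (fun w => Outcome.beats (glue a o1 o2) a w)
      = ∏ e : {e : MatchPair n // inv a e} with oth a e.1 ∈ g, T.p a (oth a e.1) := by
  have h1 : ∀ o1 : {e : MatchPair n // inv a e} → Bool,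
      (∏ e, mfac T e.1 (o1 e)) * gInd g (fun w => Outcome.beats (glue a o1 o2) a w) =
      ∏ e : {e : MatchPair n // inv a e}, (fun (e : {e : MatchPair n // inv a e}) (b : Bool) =>
        mfac T e.1 b *
          (if oth a e.1 ∈ g → b = decide (e.1.val.1 = a) then (1 : ℝ) else 0)) e (o1 e) := by
    intro o1
    rw [gInd_bits a g hg, ← Finset.prod_mul_distrib]
    exact Finset.prod_congr rfl fun e _ => by rw [glue_inv _ _ _ _ e.2]
  rw [Finset.sum_congr rfl fun o1 _ => h1 o1, sum_pi_prod (fun (e : {e : MatchPair n // inv a e})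
    (b : Bool) => mfac T e.1 b *
      (if oth a e.1 ∈ g → b = decide (e.1.val.1 = a) then (1 : ℝ) else 0)), Finset.prod_filter]
  refine Finset.prod_congr rfl fun e _ => ?_
  by_cases h : oth a e.1 ∈ g
  · simp only [h, forall_const, if_true, mul_ite, mul_one, mul_zero]
    rw [Finset.sum_ite_eq']
    simp [mfac_win T a e.1 e.2]
  · simp only [h, IsEmpty.forall_iff, if_true, mul_one, if_false]
    exact mfac_sum T e.1

theorem key_diff (E : ElimRule) {ε : ℝ} (hε : ε ∈ Set.Icc (0 : ℝ) (1/2)) {m : ℕ}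
    (U V : ProbTournament m) (hU : WeaklyBounded ε m U) (hV : WeaklyBounded ε m V) (a : Fin m)
    (hUV : ∀ i j, i ≠ j → i ≠ a → j ≠ a → U.p i j = V.p i j) :
    |rP (recWin E) U a - rP (recWin E) V a| ≤ 2*ε := by
  unfold rP
  rw [expect_split U a, expect_split V a]
  have hc : ∀ o2 : {e : MatchPair m // ¬ inv a e} → Bool,
      (∏ e, mfac V e.1 (o2 e)) = ∏ e, mfac U e.1 (o2 e) := by
    intro o2
    refine Finset.prod_congr rfl fun e _ => ?_
    have h := e.2
    simp only [inv, not_or] at h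
    unfold mfac
    rw [hUV _ _ e.1.2.ne h.1 h.2, hUV _ _ e.1.2.ne' h.2 h.1]
  have hsum : ∑ o2 : {e : MatchPair m // ¬ inv a e} → Bool, ∏ e, mfac U e.1 (o2 e) = 1 := by
    rw [sum_pi_prod (fun (e : {e : MatchPair m // ¬ inv a e}) b => mfac U e.1 b)]
    simp only [mfac_sum, Finset.prod_const_one]
  rw [← Finset.sum_sub_distrib]
  have hb : ∀ o2 : {e : MatchPair m // ¬ inv a e} → Bool,
      |(∑ o1 : {e : MatchPair m // inv a e} → Bool,
        (∏ e, mfac U e.1 (o1 e)) * recWin E m (glue a o1 o2) a) -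
       (∑ o1 : {e : MatchPair m // inv a e} → Bool,
        (∏ e, mfac V e.1 (o1 e)) * recWin E m (glue a o1 o2) a)| ≤ 2*ε := by
    intro o2
    obtain ⟨f, hf, hfo⟩ := gauntlet_rep E m m (glue a (fun _ => true) o2) a
    have hrec : ∀ o1, recWin E m (glue a o1 o2) a
        = f (fun w => Outcome.beats (glue a o1 o2) a w) := by
      intro o1
      apply hfo
      intro i j hi hj
      unfold Outcome.beats
      split_ifs with h h
      · rw [glue_not_inv, glue_not_inv]; simp [inv, hi, hj]
      · rw [glue_not_inv, glue_not_inv]; simp [inv, hi, hj]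
      · rfl
    simp only [hrec]
    let L : ProbTournament m → ((Fin m → Bool) → ℝ) →ₗ[ℝ] ℝ := fun T =>
      { toFun := fun f => ∑ o1 : {e : MatchPair m // inv a e} → Bool,
          (∏ e, mfac T e.1 (o1 e)) * f (fun w => Outcome.beats (glue a o1 o2) a w)
        map_add' := by intro f g; simp [mul_add, Finset.sum_add_distrib]
        map_smul' := by intro c f; simp [Finset.mul_sum, mul_left_comm] }
    have hsub : gHull m a ⊆ (L U - L V) ⁻¹' Set.Icc (-(2*ε)) (2*ε) := by
      apply convexHull_min
      · rintro _ (rfl | ⟨g, hg, rfl⟩)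
        · simp [hε.1]
        · have := prod_diff_le hε
            (Finset.univ.filter fun e : {e : MatchPair m // inv a e} => oth a e.1 ∈ g)
            (fun e => U.p a (oth a e.1)) (fun e => V.p a (oth a e.1))
            (fun e _ => hU _ _ (oth_ne a e.1).symm) (fun e _ => hV _ _ (oth_ne a e.1).symm)
          rw [← gen_expect U a g hg o2, ← gen_expect V a g hg o2] at this
          exact abs_le.1 this
      · exact (convex_Icc _ _).linear_preimage _
    exact abs_le.2 (hsub hf)
  calc _ ≤ ∑ o2 : {e : MatchPair m // ¬ inv a e} → Bool, (∏ e, mfac U e.1 (o2 e)) * (2*ε) := by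
        refine (Finset.abs_sum_le_sum_abs _ _).trans (Finset.sum_le_sum fun o2 _ => ?_)
        rw [hc, ← mul_sub, abs_mul, abs_of_nonneg (Finset.prod_nonneg fun e _ => mfac_nonneg _ _ _)]
        exact mul_le_mul_of_nonneg_left (hb o2) (Finset.prod_nonneg fun e _ => mfac_nonneg _ _ _)
    _ = 2*ε := by rw [← Finset.sum_mul, hsum, one_mul]

/-! ### Relabeling -/

/-- Pulling back a tournament along an embedding. -/
def pullT {n m : ℕ} (T : ProbTournament n) (e : Fin m ↪ Fin n) : ProbTournament m where
  p a b := T.p (e a) (e b)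
  mem_Icc _ _ := T.mem_Icc _ _
  compl a b hab := T.compl _ _ (fun h => hab (e.injective h))

theorem rP_congr (r : ∀ n : ℕ, Outcome n → Fin n → ℝ) {m : ℕ} (U V : ProbTournament m)
    (h : ∀ i j, i ≠ j → U.p i j = V.p i j) (a : Fin m) : rP r U a = rP r V a := by
  unfold rP
  refine Finset.sum_congr rfl fun o _ => ?_
  congr 1
  rw [prob_eq, prob_eq]
  refine Finset.prod_congr rfl fun e _ => ?_
  unfold mfac
  rw [h _ _ e.2.ne, h _ _ e.2.ne']

/-- Relabeling a match. -/
noncomputable def permPair {n : ℕ} (σ : Equiv.Perm (Fin n)) (e : MatchPair n) : MatchPair n :=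
  if h : σ e.val.1 < σ e.val.2 then ⟨(σ e.val.1, σ e.val.2), h⟩
  else ⟨(σ e.val.2, σ e.val.1), lt_of_le_of_ne (not_lt.mp h)
    (fun h' => e.2.ne' (σ.injective h'))⟩

theorem permPair_symm {n : ℕ} (σ : Equiv.Perm (Fin n)) (e : MatchPair n) :
    permPair σ.symm (permPair σ e) = e := by
  obtain ⟨⟨i, j⟩, hij⟩ := e
  by_cases h : σ i < σ j
  · simp only [permPair, h, dif_pos, Equiv.symm_apply_apply]; rw [dif_pos hij]
  · simp only [permPair, h, dif_neg, not_false_iff, Equiv.symm_apply_apply]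
    rw [dif_neg (not_lt.mpr hij.le)]

theorem prob_perm {m : ℕ} (U : ProbTournament m) (σ : Equiv.Perm (Fin m)) (o : Outcome m) :
    U.prob (permOutcome σ o) = (pullT U σ.toEmbedding).prob o := by
  rw [prob_eq, prob_eq]
  symm
  refine Finset.prod_bij' (fun e _ => permPair σ e) (fun e _ => permPair σ.symm e)
    (by simp) (by simp) (fun e _ => permPair_symm σ e)
    (fun e _ => permPair_symm σ.symm e) ?_
  intro e _
  by_cases h : σ e.val.1 < σ e.val.2
  · have hb : Outcome.beats o e.val.1 e.val.2 = o e := by simp [Outcome.beats, e.2]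
    simp only [permPair, h, dif_pos, mfac, permOutcome, pullT, Equiv.symm_apply_apply, hb]
    rfl
  · have hb : Outcome.beats o e.val.2 e.val.1 = !o e := by
      rw [beats_swap o e.2.ne]; simp [Outcome.beats, e.2]
    simp only [permPair, h, dif_neg, not_false_iff, mfac, permOutcome, pullT,
      Equiv.symm_apply_apply, hb]
    cases o e <;> simp

theorem permOutcome_symm {m : ℕ} (σ : Equiv.Perm (Fin m)) (o : Outcome m) :
    permOutcome σ.symm (permOutcome σ o) = o := by
  apply outcome_ext
  intro i j
  rw [beats_perm, beats_perm]; simp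

theorem rP_perm (r : ∀ n : ℕ, Outcome n → Fin n → ℝ) (hr : IsAnonymous r) {m : ℕ}
    (U : ProbTournament m) (σ : Equiv.Perm (Fin m)) (a : Fin m) :
    rP r (pullT U σ.toEmbedding) a = rP r U (σ a) := by
  unfold rP
  refine Finset.sum_bij' (fun o _ => permOutcome σ o) (fun o _ => permOutcome σ.symm o)
    (by simp) (by simp) (fun o _ => permOutcome_symm σ o) (fun o _ => permOutcome_symm σ.symm o) ?_
  intro o _
  rw [prob_perm, hr]

theorem rPS_single (r : ∀ n : ℕ, Outcome n → Fin n → ℝ) (hr : IsAnonymous r) {n m : ℕ}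
    (T : ProbTournament n) (s : Finset (Fin n)) (u v : Fin n) (hv : v ∉ s)
    (e : Fin m ↪ Fin n) (he : Finset.univ.map e = s) (a : Fin m) (ha : e a = u) :
    rPS r (restrictProb T s) (mapTeams s {u, v}) = rP r (pullT T e) a := by
  have hm : m = s.card := by rw [← he]; simp
  subst hm
  have hmem : ∀ i, e i ∈ s := fun i =>
    he.subset (Finset.mem_map_of_mem e (Finset.mem_univ i))
  let σ0 : Fin s.card → Fin s.card := fun i => (s.orderIsoOfFin rfl).symm ⟨e i, hmem i⟩
  have hσ0 : Function.Injective σ0 := by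
    intro i j h
    have := (s.orderIsoOfFin rfl).symm.injective h
    exact e.injective (congrArg Subtype.val this)
  let σ : Equiv.Perm (Fin s.card) := Equiv.ofBijective σ0 (Finite.injective_iff_bijective.1 hσ0)
  have hσ : ∀ i, (s.orderIsoOfFin rfl (σ i) : Fin n) = e i := by
    intro i
    change ((s.orderIsoOfFin rfl ((s.orderIsoOfFin rfl).symm ⟨e i, hmem i⟩)) : Fin n) = e i
    rw [OrderIso.apply_symm_apply]
  have h1 : mapTeams s {u, v} = {σ a} := by
    ext i
    simp only [mapTeams, Finset.mem_filter, Finset.mem_univ, true_and, Finset.mem_insert,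
      Finset.mem_singleton]
    constructor
    · rintro (h | h)
      · apply (s.orderIsoOfFin rfl).injective
        apply Subtype.ext
        rw [h, hσ, ha]
      · exact absurd (h ▸ (s.orderIsoOfFin rfl i).2) hv
    · rintro rfl
      left; rw [hσ, ha]
  rw [rPS, h1, Finset.sum_singleton, ← rP_perm r hr]
  apply rP_congr
  intro i j _
  change T.p (s.orderIsoOfFin rfl (σ i)) (s.orderIsoOfFin rfl (σ j)) = T.p (e i) (e j)
  rw [hσ, hσ]

/-! ### The first round -/

theorem opponents_matching {n : ℕ} {M : Finset (MatchPair n)} (hM : IsMatchingSet M)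
    {u v w : Fin n} (h : v ∈ opponents M u) (h' : w ∈ opponents M u) : w = v := by
  obtain ⟨e, he, h⟩ := (mem_opponents _ _ _).1 h
  obtain ⟨e', he', h'⟩ := (mem_opponents _ _ _).1 h'
  by_cases hee : e = e'
  · subst hee
    have := e.2
    rcases h with h | h <;> rcases h' with h' | h' <;> rw [h] at h' <;> simp at h'
    · exact h'.symm
    · rw [h] at this; simp only [h'] at this; exact absurd this (lt_irrefl _)
    · rw [h] at this; simp only [h'] at this; exact absurd this (lt_irrefl _)
    · exact h'.symm
  · have := hM e he e' he' hee
    rcases h with h | h <;> rcases h' with h' | h' <;> rw [h, h'] at this <;> simp at this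

theorem surv_pair {n : ℕ} {M : Finset (MatchPair n)} (hM : IsMatchingSet M)
    {u v : Fin n} (huv : v ∈ opponents M u) (o1 o2 : Outcome n)
    (h1 : Outcome.beats o1 u v = true) (h2 : Outcome.beats o2 v u = true)
    (hag : ∀ i j, ¬ (i = u ∧ j = v) → ¬ (i = v ∧ j = u) →
      Outcome.beats o1 i j = Outcome.beats o2 i j) :
    u ∈ survivors o1 M ∧ v ∉ survivors o1 M ∧ u ∉ survivors o2 M ∧
      (survivors o2 M) = (survivors o1 M).map (Equiv.swap u v).toEmbedding := by
  have hne : u ≠ v := by rintro rfl; exact self_not_mem_opponents _ _ huv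
  have hvu := opponents_symm huv
  have a1 : u ∈ survivors o1 M := by
    rw [mem_survivors_iff]; intro j hj
    rw [opponents_matching hM huv hj, h1]
  have a2 : v ∈ survivors o2 M := by
    rw [mem_survivors_iff]; intro j hj
    rw [opponents_matching hM hvu hj, h2]
  have a3 : v ∉ survivors o1 M := by
    rw [mem_survivors_iff]; intro h
    have := h u hvu
    rw [beats_swap _ hne, h1] at this; simp at this
  have a4 : u ∉ survivors o2 M := by
    rw [mem_survivors_iff]; intro h
    have := h v huv
    rw [beats_swap _ hne.symm, h2] at this; simp at this
  refine ⟨a1, a3, a4, ?_⟩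
  ext i
  rw [Finset.mem_map_equiv, Equiv.symm_swap]
  by_cases hu : i = u
  · subst hu; simp [a3, a4]
  · by_cases hv : i = v
    · subst hv; simp [a1, a2]
    · rw [Equiv.swap_apply_of_ne_of_ne hu hv, mem_survivors_iff, mem_survivors_iff]
      refine forall₂_congr fun j _ => ?_
      rw [hag i j (fun h => hu h.1) (fun h => hv h.1)]

theorem pull_bounded {ε : ℝ} {n m : ℕ} {T : ProbTournament n} (hT : WeaklyBounded ε n T)
    (e : Fin m ↪ Fin n) : WeaklyBounded ε m (pullT T e) :=
  fun i j hij => hT _ _ (fun h => hij (e.injective h))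

theorem surv_value (E : ElimRule) (hanon : IsAnonymous (recWin E)) {ε : ℝ}
    (hε : ε ∈ Set.Icc (0 : ℝ) (1/2)) {n : ℕ} (T : ProbTournament n)
    (hT : WeaklyBounded ε n T) (u v : Fin n) (s1 s2 : Finset (Fin n))
    (hu : u ∈ s1) (hv : v ∉ s1) (hu2 : u ∉ s2)
    (hs : s2 = s1.map (Equiv.swap u v).toEmbedding) :
    |rPS (recWin E) (restrictProb T s1) (mapTeams s1 {u, v}) -
      rPS (recWin E) (restrictProb T s2) (mapTeams s2 {u, v})| ≤ 2*ε := by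
  let e : Fin s1.card ↪ Fin n := (s1.orderEmbOfFin rfl).toEmbedding
  have he : Finset.univ.map e = s1 := by
    simp [e]
  obtain ⟨a, -, ha⟩ := Finset.mem_map.1 (he.symm ▸ hu)
  rw [rPS_single _ hanon T s1 u v hv e he a ha, Finset.pair_comm u v,
    rPS_single _ hanon T s2 v u hu2 (e.trans (Equiv.swap u v).toEmbedding)
      (by rw [hs, ← Finset.map_map, he]) a (by simp [ha])]
  apply key_diff E hε _ _ (pull_bounded hT _) (pull_bounded hT _)
  intro i j _ hi hj
  have key : ∀ i, i ≠ a → (Equiv.swap u v) (e i) = e i := by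
    intro i hi
    apply Equiv.swap_apply_of_ne_of_ne
    · rw [← ha]; exact fun h => hi (e.injective h)
    · rintro h; apply hv; rw [← h]
      exact he.subset (Finset.mem_map_of_mem e (Finset.mem_univ i))
  simp [pullT, key i hi, key j hj]

theorem surv_value_eq (r : ∀ n : ℕ, Outcome n → Fin n → ℝ) {n : ℕ} (T T' : ProbTournament n)
    (u v : Fin n) (hadj : Adjacent {u, v} T T') (s : Finset (Fin n)) (S : Finset (Fin s.card))
    (h : u ∉ s ∨ v ∉ s) :
    rPS r (restrictProb T' s) S = rPS r (restrictProb T s) S := by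
  unfold rPS
  refine Finset.sum_congr rfl fun a _ => rP_congr r _ _ ?_ a
  intro i j hij
  symm
  apply hadj
  have hne : (s.orderIsoOfFin rfl i : Fin n) ≠ s.orderIsoOfFin rfl j :=
    fun h => hij ((s.orderIsoOfFin rfl).injective (Subtype.coe_injective h))
  have hi := (s.orderIsoOfFin rfl i).2
  have hj := (s.orderIsoOfFin rfl j).2
  simp only [Finset.mem_insert, Finset.mem_singleton]
  rintro ⟨h1 | h1, h2 | h2⟩ <;> rw [h1] at hi hne <;> rw [h2] at hj hne <;> tauto

theorem two_sum {ι : Type*} [Fintype ι] [DecidableEq ι] (e0 : ι) (h : (ι → Bool) → ℝ) :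
    2 * ∑ o, h o = ∑ o : ι → Bool,
      (h (Function.update o e0 true) + h (Function.update o e0 false)) := by
  let φ : (ι → Bool) ≃ (ι → Bool) :=
    { toFun := fun o => Function.update o e0 (!o e0)
      invFun := fun o => Function.update o e0 (!o e0)
      left_inv := by intro o; simp
      right_inv := by intro o; simp }
  have h1 : ∑ o, h (φ o) = ∑ o, h o := Equiv.sum_comp φ h
  rw [two_mul]
  nth_rewrite 2 [← h1]
  rw [← Finset.sum_add_distrib]
  refine Finset.sum_congr rfl fun o _ => ?_
  change h o + h (Function.update o e0 (!o e0)) = _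
  cases hb : o e0
  · have : Function.update o e0 false = o := by rw [← hb]; simp
    rw [this, add_comm]; rfl
  · have : Function.update o e0 true = o := by rw [← hb]; simp
    rw [this]; rfl

theorem prob_update {n : ℕ} (T : ProbTournament n) (e0 : MatchPair n) (o : Outcome n) (b : Bool) :
    T.prob (Function.update o e0 b) =
      mfac T e0 b * ∏ e ∈ Finset.univ.erase e0, mfac T e (o e) := by
  rw [prob_eq, ← Finset.mul_prod_erase _ _ (Finset.mem_univ e0), Function.update_self]
  congr 1
  refine Finset.prod_congr rfl fun e he => ?_
  rw [Function.update_of_ne (Finset.ne_of_mem_erase he)]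

theorem gain_le (E : ElimRule) (hanon : IsAnonymous (recWin E)) (ε : ℝ)
    (hε : ε ∈ Set.Icc (0 : ℝ) (1/2)) {n : ℕ} (T T' : ProbTournament n)
    (hT : WeaklyBounded ε n T) (u v : Fin n) (huv : u < v) (hadj : Adjacent {u, v} T T')
    (M : Finset (MatchPair n)) (hM : IsMatchingSet M) (hmem : v ∈ opponents M u) :
    valAfter (recWin E) T' M {u, v} - valAfter (recWin E) T M {u, v} ≤ 2*ε*(1/2 + ε) := by
  set e0 : MatchPair n := ⟨(u, v), huv⟩ with he0
  set G : Outcome n → ℝ := fun o =>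
    rPS (recWin E) (restrictProb T (survivors o M)) (mapTeams (survivors o M) {u, v}) with hG
  set R : Outcome n → ℝ := fun o => ∏ e ∈ Finset.univ.erase e0, mfac T e (o e) with hR
  have hR' : ∀ o : Outcome n, ∏ e ∈ Finset.univ.erase e0, mfac T' e (o e) = R o := by
    intro o
    refine Finset.prod_congr rfl fun e he => ?_
    have hne := Finset.ne_of_mem_erase he
    have h1 : ¬ (e.val.1 ∈ ({u, v} : Finset (Fin n)) ∧ e.val.2 ∈ ({u, v} : Finset (Fin n))) := by
      simp only [Finset.mem_insert, Finset.mem_singleton]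
      have hlt := e.2
      rintro ⟨h1 | h1, h2 | h2⟩ <;> rw [h1, h2] at hlt
      · exact lt_irrefl _ hlt
      · exact hne (Subtype.ext (Prod.ext h1 h2))
      · exact lt_asymm hlt huv
      · exact lt_irrefl _ hlt
    unfold mfac
    rw [hadj _ _ h1, hadj _ _ (fun h => h1 h.symm)]
  have hsv : ∀ o : Outcome n, _ := fun o =>
    surv_pair hM hmem (Function.update o e0 true) (Function.update o e0 false)
      (by simp [Outcome.beats, huv, he0])
      (by simp [Outcome.beats, huv, he0, not_lt.mpr huv.le])
      (by
        intro i j h1 h2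
        unfold Outcome.beats
        split_ifs with h h
        · rw [Function.update_of_ne, Function.update_of_ne] <;>
          · intro h'; have := congrArg Subtype.val h'; simp [he0] at this; exact h1 this
        · rw [Function.update_of_ne, Function.update_of_ne] <;>
          · intro h'; have := congrArg Subtype.val h'; simp [he0] at this
            exact h2 ⟨this.2, this.1⟩
        · rfl)
  have hGd : ∀ o, |G (Function.update o e0 true) - G (Function.update o e0 false)| ≤ 2*ε := by
    intro o
    obtain ⟨a1, a2, a3, a4⟩ := hsv o
    exact surv_value E hanon hε T hT u v _ _ a1 a2 a3 a4
  have hv1 : 2 * valAfter (recWin E) T M {u, v} = ∑ o : Outcome n, R o *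
      (T.p u v * G (Function.update o e0 true) + T.p v u * G (Function.update o e0 false)) := by
    unfold valAfter
    rw [two_sum e0]
    refine Finset.sum_congr rfl fun o _ => ?_
    rw [prob_update, prob_update]
    simp only [mfac, he0, hR, hG]
    simp only [if_true, Bool.false_eq_true, if_false]
    ring
  have hv2 : 2 * valAfter (recWin E) T' M {u, v} = ∑ o : Outcome n, R o *
      (T'.p u v * G (Function.update o e0 true) + T'.p v u * G (Function.update o e0 false)) := by
    unfold valAfter
    rw [two_sum e0]
    refine Finset.sum_congr rfl fun o _ => ?_
    obtain ⟨a1, a2, a3, a4⟩ := hsv o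
    rw [prob_update, prob_update, hR', surv_value_eq _ T T' u v hadj _ _ (Or.inr a2),
      surv_value_eq _ T T' u v hadj _ _ (Or.inl a3)]
    simp only [mfac, he0, hG]
    simp only [if_true, Bool.false_eq_true, if_false]
    ring
  have hRs : ∑ o : Outcome n, R o = 2 := by
    have := two_sum e0 (fun o => T.prob o)
    rw [prob_sum, mul_one] at this
    rw [this]
    refine Finset.sum_congr rfl fun o _ => ?_
    rw [prob_update, prob_update, ← add_mul]
    have h1 := T.compl u v huv.ne
    simp [mfac, he0, h1, hR]
  have hR0 : ∀ o, 0 ≤ R o := fun o => Finset.prod_nonneg fun e _ => mfac_nonneg _ _ _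
  have hc := T.compl u v huv.ne
  have hc' := T'.compl u v huv.ne
  have hp := hT u v huv.ne
  have hp' := T'.mem_Icc u v
  have hd : |T'.p u v - T.p u v| ≤ 1/2 + ε := by
    rw [abs_le]; constructor <;> linarith [hp.1, hp.2, hp'.1, hp'.2]
  have hfin : 2 * (valAfter (recWin E) T' M {u, v} - valAfter (recWin E) T M {u, v})
      ≤ 2 * (2*ε*(1/2+ε)) := by
    rw [mul_sub, hv1, hv2, ← Finset.sum_sub_distrib, ← hRs, Finset.sum_mul]
    refine Finset.sum_le_sum fun o _ => ?_
    rw [← mul_sub]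
    apply mul_le_mul_of_nonneg_left _ (hR0 o)
    have e1 : T'.p v u = 1 - T'.p u v := by linarith
    have e2 : T.p v u = 1 - T.p u v := by linarith
    rw [e1, e2]
    calc _ = (T'.p u v - T.p u v) *
          (G (Function.update o e0 true) - G (Function.update o e0 false)) := by ring
      _ ≤ |T'.p u v - T.p u v| *
          |G (Function.update o e0 true) - G (Function.update o e0 false)| := by
          rw [← abs_mul]; exact le_abs_self _
      _ ≤ (1/2+ε) * (2*ε) := by
          apply mul_le_mul hd (hGd o) (abs_nonneg _)
          linarith [hε.1]
      _ = _ := by rw [hRs]; ring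
  linarith

theorem stmt8 (E : ElimRule) (hmatch : E.IsMatchingRule)
    (hanon : IsAnonymous (recWin E)) (ε : ℝ) (hε : ε ∈ Set.Icc (0 : ℝ) (1/2))
    {n : ℕ} (T T' : ProbTournament n) (hT : WeaklyBounded ε n T)
    (u v : Fin n) (huv : u ≠ v) (hadj : Adjacent {u, v} T T') :
    (∑ M : Finset (MatchPair n), E.d n M *
        (if matchMem M u v then
          valAfter (recWin E) T' M {u, v} - valAfter (recWin E) T M {u, v} else 0))
    ≤ 2*ε*(1/2 + ε) *
        ∑ M : Finset (MatchPair n), E.d n M * (if matchMem M u v then 1 else 0) := by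
  rw [Finset.mul_sum]
  refine Finset.sum_le_sum fun M _ => ?_
  by_cases hd : E.d n M = 0
  · simp [hd]
  have hM := hmatch n M hd
  by_cases hm : matchMem M u v
  · have hmem : v ∈ opponents M u := (mem_opponents _ _ _).2 hm
    rw [if_pos hm, if_pos hm, mul_one, mul_comm]
    apply mul_le_mul_of_nonneg_right _ (E.nonneg n M)
    rcases lt_or_gt_of_ne huv with h | h
    · exact gain_le E hanon ε hε T T' hT u v h hadj M hM hmem
    · rw [Finset.pair_comm u v] at hadj ⊢
      exact gain_le E hanon ε hε T T' hT v u h hadj M hM (opponents_symm hmem)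
  · simp [hm]
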